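/- arXiv:1709.00543 — 2 statements merged into one kernel-verified Lean document; each statement's English description precedes it below -/
import Mathlib

section
/- Let G be a tree on a finite vertex set V with edge set E (so |V| = |E| + 1), let q ∈ [0,1], and let τ : V → {-1, +1} be a spin configuration. Let A ⊆ E be the set of edges whose two endpoints carry equal values of τ. For O ⊆ E let c(O) denote the number of connected components of the spanning subgraph of G with edge set O. Then ∑_{O ⊆ A} (1-q)^{|O|} · q^{|E| - |O|} · (1/2)^{c(O)} = (1/2) · (q/2)^{|E| - |A|} · (1 - q/2)^{|A|}. -/
namespace SimpleGraph

/-- Joining two vertices in distinct connected components merges exactly these two components. -/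
theorem card_connectedComponent_sup_edge_of_not_reachable {V : Type*} [Finite V]
    {G : SimpleGraph V} {u v : V} (huv : ¬ G.Reachable u v) :
    Nat.card (G ⊔ edge u v).ConnectedComponent + 1 = Nat.card G.ConnectedComponent := by
  classical
  have hne : u ≠ v := fun h => huv (h ▸ Reachable.refl u)
  have hedge : (G ⊔ edge u v).Reachable u v :=
    Adj.reachable (Or.inr ((edge_adj u v u v).2 ⟨Or.inl ⟨rfl, rfl⟩, hne⟩))
  let f : V → {c : G.ConnectedComponent // c ≠ G.connectedComponentMk v} := fun x =>
    if h : G.Reachable x v then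
      ⟨G.connectedComponentMk u, fun e => huv (ConnectedComponent.exact e)⟩
    else ⟨G.connectedComponentMk x, fun e => h (ConnectedComponent.exact e)⟩
  have hf_adj : ∀ x y, (G ⊔ edge u v).Adj x y → f x = f y := by
    rintro x y (h | h)
    · have hiff : G.Reachable x v ↔ G.Reachable y v :=
        ⟨h.reachable.symm.trans, h.reachable.trans⟩
      have hmk : G.connectedComponentMk x = G.connectedComponentMk y :=
        ConnectedComponent.sound h.reachable
      simp [f, hiff, hmk]
    · rcases ((edge_adj u v x y).1 h).1 with ⟨rfl, rfl⟩ | ⟨rfl, rfl⟩ <;> simp [f, huv]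
  have hf_walk : ∀ x y (p : (G ⊔ edge u v).Walk x y), f x = f y := by
    intro x y p
    induction p with
    | nil => rfl
    | cons h _ ih => exact (hf_adj _ _ h).trans ih
  let g := ConnectedComponent.lift f fun x y p _ => hf_walk x y p
  have hg : Function.Bijective g := by
    constructor
    · refine ConnectedComponent.ind₂ fun x y h => ConnectedComponent.sound ?_
      have hxy : f x = f y := h
      have lift_le : ∀ {a b}, G.Reachable a b → (G ⊔ edge u v).Reachable a b :=
        fun h => h.mono le_sup_left
      by_cases hx : G.Reachable x v <;> by_cases hy : G.Reachable y v <;>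
        simp only [f, hx, hy, dite_true, dite_false, Subtype.mk.injEq,
          ConnectedComponent.eq] at hxy
      · exact lift_le (hx.trans hy.symm)
      · exact (lift_le hx).trans (hedge.symm.trans (lift_le hxy))
      · exact (lift_le hxy).trans (hedge.trans (lift_le hy.symm))
      · exact lift_le hxy
    · rintro ⟨c, hc⟩
      induction c using ConnectedComponent.ind with
      | h x =>
        refine ⟨(G ⊔ edge u v).connectedComponentMk x, ?_⟩
        have hx : ¬ G.Reachable x v := fun h => hc (ConnectedComponent.sound h)
        change f x = _
        simp [f, hx]
  rw [Nat.card_eq_of_bijective g hg, ← Finite.card_option]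
  exact Nat.card_congr (Equiv.optionSubtypeNe _)

/-- A spanning forest with edge set `O` has `|V| - |O|` connected components. -/
theorem IsAcyclic.card_connectedComponent_fromEdgeSet_add_card {V : Type*} [Finite V]
    {G : SimpleGraph V} (hG : G.IsAcyclic) (O : Finset (Sym2 V)) (hO : ↑O ⊆ G.edgeSet) :
    Nat.card (fromEdgeSet (↑O : Set (Sym2 V))).ConnectedComponent + O.card = Nat.card V := by
  classical
  induction O using Finset.induction_on with
  | empty =>
    rw [Finset.coe_empty, fromEdgeSet_empty, Finset.card_empty, add_zero]
    refine (Nat.card_eq_of_bijective (connectedComponentMk ⊥) ⟨fun x y h => ?_, ?_⟩).symm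
    · simpa using h
    · exact Quot.mk_surjective
  | insert e O he ih =>
    rw [Finset.coe_insert, Set.insert_subset_iff] at hO
    have hcard := ih hO.2
    induction e using Sym2.ind with
    | _ u v =>
      have hnot : ¬ (fromEdgeSet (↑O : Set (Sym2 V))).Reachable u v := by
        refine fun h => isAcyclic_iff_forall_isBridge.1 hG hO.1 (h.mono fun x y hxy => ?_)
        obtain ⟨hmem, -⟩ := (fromEdgeSet_adj _).1 hxy
        exact deleteEdges_adj.2 ⟨hO.2 hmem, fun h => he (h ▸ hmem)⟩
      have hsup : fromEdgeSet (↑(insert s(u, v) O) : Set (Sym2 V)) =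
          fromEdgeSet (↑O : Set (Sym2 V)) ⊔ edge u v := by
        rw [edge, Finset.coe_insert, Set.insert_eq, Set.union_comm, fromEdgeSet_union]
      have hmerge := card_connectedComponent_sup_edge_of_not_reachable hnot
      rw [hsup, Finset.card_insert_of_notMem he]
      omega

end SimpleGraph


/-- Edwards–Sokal identity on a finite tree: open each edge independently with probability
`1-q`, require the spin configuration `τ` to be constant on connected components (so only
subsets `O` of the set `A` of edges with agreeing endpoints contribute), and give each
connected component an independent uniform `±1` sign.  The resulting probability of `τ`
equals `(1/2)·(q/2)^{|E|-|A|}·(1-q/2)^{|A|}`. -/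
theorem edwards_sokal_on_tree {V : Type*} [Fintype V] [DecidableEq V]
    (G : SimpleGraph V) [DecidableRel G.Adj] (hG : G.IsTree)
    (q : ℝ) (hq : q ∈ Set.Icc (0 : ℝ) 1)
    (τ : V → ℤ) (hτ : ∀ v, τ v = 1 ∨ τ v = -1)
    (A : Finset (Sym2 V))
    (hA : A = G.edgeFinset.filter (fun e => ∀ x ∈ e, ∀ y ∈ e, τ x = τ y)) :
    ∑ O ∈ A.powerset,
      (1 - q) ^ O.card * q ^ (G.edgeFinset.card - O.card) *
        (1 / 2 : ℝ) ^ Nat.card (SimpleGraph.fromEdgeSet (↑O : Set (Sym2 V))).ConnectedComponent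
    = (1 / 2) * (q / 2) ^ (G.edgeFinset.card - A.card) * (1 - q / 2) ^ A.card := by
  have hAE : A ⊆ G.edgeFinset := hA ▸ Finset.filter_subset _ _
  have hAcard := Finset.card_le_card hAE
  have hV := hG.card_edgeFinset
  have hterm : ∀ O ∈ A.powerset,
      (1 - q) ^ O.card * q ^ (G.edgeFinset.card - O.card) *
        (1 / 2 : ℝ) ^ Nat.card (SimpleGraph.fromEdgeSet (↑O : Set (Sym2 V))).ConnectedComponent
      = (1 / 2) * (q / 2) ^ (G.edgeFinset.card - A.card) *
        ((1 - q) ^ O.card * (q / 2) ^ (A.card - O.card)) := by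
    intro O hO
    have hOA := Finset.mem_powerset.1 hO
    have hOcard := Finset.card_le_card hOA
    have hc := hG.isAcyclic.card_connectedComponent_fromEdgeSet_add_card O
      fun e he => SimpleGraph.mem_edgeFinset.1 (hAE (hOA he))
    rw [Nat.card_eq_fintype_card (α := V)] at hc
    have hcomp : Nat.card (SimpleGraph.fromEdgeSet (↑O : Set (Sym2 V))).ConnectedComponent =
        (G.edgeFinset.card - A.card) + (A.card - O.card) + 1 := by omega
    have hexp : G.edgeFinset.card - O.card =
        (G.edgeFinset.card - A.card) + (A.card - O.card) := by omega
    rw [hcomp, hexp, div_eq_mul_one_div q 2, mul_pow, mul_pow]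
    ring
  rw [Finset.sum_congr rfl hterm, ← Finset.mul_sum, Finset.sum_pow_mul_eq_add_pow]
  congr 2
  ring
end

section
/- Let G be a tree on a finite vertex set V with edge set E, let β ∈ ℝ, and let a, b ∈ V. For σ : V → {-1, +1} define the weight w(σ) = exp(β · ∑_{{x,y} ∈ E} σ(x)σ(y)). Then (∑_{σ : V → {-1,+1}} σ(a)·σ(b)·w(σ)) / (∑_{σ : V → {-1,+1}} w(σ)) = (tanh β)^{d(a,b)}, where d(a,b) is the graph distance between a and b in G. -/
/-- Negation of a `±1`-valued spin. -/
def negSpin (s : ({-1, 1} : Finset ℝ)) : ({-1, 1} : Finset ℝ) :=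
  ⟨-s, by
    have h := s.2
    simp only [Finset.mem_insert, Finset.mem_singleton] at h ⊢
    rcases h with h | h <;> simp [h]⟩

lemma coe_negSpin (s : ({-1, 1} : Finset ℝ)) : (negSpin s : ℝ) = -s := rfl

lemma spin_mul_self (s : ({-1, 1} : Finset ℝ)) : (s : ℝ) * s = 1 := by
  have h := s.2
  simp only [Finset.mem_insert, Finset.mem_singleton] at h
  rcases h with h | h <;> simp [h]

open Classical in
/-- Flip all spins in `B`. -/
noncomputable def flipSpins {V : Type*} (B : Set V) (σ : V → ({-1, 1} : Finset ℝ)) :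
    V → ({-1, 1} : Finset ℝ) :=
  fun v => if v ∈ B then negSpin (σ v) else σ v

lemma flipSpins_of_mem {V : Type*} {B : Set V} {v : V} (hv : v ∈ B)
    (σ : V → ({-1, 1} : Finset ℝ)) : (flipSpins B σ v : ℝ) = -σ v := by
  simp [flipSpins, hv, coe_negSpin]

lemma flipSpins_of_notMem {V : Type*} {B : Set V} {v : V} (hv : v ∉ B)
    (σ : V → ({-1, 1} : Finset ℝ)) : (flipSpins B σ v : ℝ) = σ v := by
  simp [flipSpins, hv]

lemma flipSpins_involutive {V : Type*} (B : Set V) : Function.Involutive (flipSpins B) := by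
  intro σ
  ext v
  by_cases hv : v ∈ B
  · rw [flipSpins_of_mem hv, flipSpins_of_mem hv, neg_neg]
  · rw [flipSpins_of_notMem hv, flipSpins_of_notMem hv]

lemma sum_eq_zero_of_flipSpins {V : Type*} [Fintype V] [DecidableEq V] (B : Set V)
    (F : (V → ({-1, 1} : Finset ℝ)) → ℝ) (hF : ∀ σ, F (flipSpins B σ) = -F σ) :
    ∑ σ, F σ = 0 := by
  have h := Equiv.sum_comp (flipSpins_involutive B).toPerm F
  simp only [Function.Involutive.coe_toPerm, hF, Finset.sum_neg_distrib] at h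
  linarith

lemma exp_mul_of_mul_self_eq_one (β : ℝ) {s : ℝ} (hs : s * s = 1) :
    Real.exp (β * s) = Real.cosh β + s * Real.sinh β := by
  rcases mul_self_eq_one_iff.mp hs with rfl | rfl
  · rw [mul_one, one_mul, Real.cosh_add_sinh]
  · rw [mul_neg_one, neg_one_mul, ← sub_eq_add_neg, Real.cosh_sub_sinh]

/-- The product of the two spins at the ends of an edge. -/
def edgeSpin {V : Type*} (σ : V → ({-1, 1} : Finset ℝ)) : Sym2 V → ℝ :=
  Sym2.lift ⟨fun x y => (σ x : ℝ) * (σ y : ℝ), fun _ _ => mul_comm _ _⟩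

lemma edgeSpin_mk {V : Type*} (σ : V → ({-1, 1} : Finset ℝ)) (x y : V) :
    edgeSpin σ s(x, y) = σ x * σ y := rfl

lemma edgeSpin_flipSpins {V : Type*} (σ : V → ({-1, 1} : Finset ℝ)) {B : Set V} {x y : V}
    (h : x ∈ B ↔ y ∈ B) : edgeSpin (flipSpins B σ) s(x, y) = edgeSpin σ s(x, y) := by
  simp only [edgeSpin_mk]
  by_cases hx : x ∈ B
  · rw [flipSpins_of_mem hx, flipSpins_of_mem (h.mp hx), neg_mul_neg]
  · rw [flipSpins_of_notMem hx, flipSpins_of_notMem (mt h.mpr hx)]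

/-- Across an edge `ac` such that no other edge leaves `B`, unnormalized two-point functions
change by a factor `tanh β`. -/
lemma sum_two_point_of_cut {V : Type*} [Fintype V] [DecidableEq V]
    (G : SimpleGraph V) [DecidableRel G.Adj] (β : ℝ) {a b c : V} (B : Set V)
    (hac : G.Adj a c) (ha : a ∈ B) (hb : b ∉ B)
    (hB : ∀ x y, G.Adj x y → s(x, y) ≠ s(a, c) → (x ∈ B ↔ y ∈ B)) :
    ∑ σ : V → ({-1, 1} : Finset ℝ), (σ a : ℝ) * (σ b : ℝ) *
        Real.exp (β * ∑ e ∈ G.edgeFinset, edgeSpin σ e) =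
      Real.tanh β * ∑ σ : V → ({-1, 1} : Finset ℝ), (σ c : ℝ) * (σ b : ℝ) *
        Real.exp (β * ∑ e ∈ G.edgeFinset, edgeSpin σ e) := by
  set w : (V → ({-1, 1} : Finset ℝ)) → ℝ := fun σ =>
    Real.exp (β * ∑ e ∈ G.edgeFinset.erase s(a, c), edgeSpin σ e) with hw
  have hsplit (σ : V → ({-1, 1} : Finset ℝ)) :
      Real.exp (β * ∑ e ∈ G.edgeFinset, edgeSpin σ e) =
        (Real.cosh β + σ a * σ c * Real.sinh β) * w σ := by
    have hs : (σ a * σ c : ℝ) * (σ a * σ c) = 1 := by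
      rw [mul_mul_mul_comm, spin_mul_self, spin_mul_self, one_mul]
    rw [← Finset.add_sum_erase _ _ (SimpleGraph.mem_edgeFinset.mpr hac : s(a, c) ∈ G.edgeFinset),
      mul_add, Real.exp_add, edgeSpin_mk, exp_mul_of_mul_self_eq_one β hs]
  have hflip (σ : V → ({-1, 1} : Finset ℝ)) : w (flipSpins B σ) = w σ := by
    simp only [hw]
    congr 2
    refine Finset.sum_congr rfl fun e he => ?_
    induction e with
    | _ x y =>
      rw [Finset.mem_erase, SimpleGraph.mem_edgeFinset, SimpleGraph.mem_edgeSet] at he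
      exact edgeSpin_flipSpins σ (hB x y he.2 he.1)
  have hzero : ∑ σ : V → ({-1, 1} : Finset ℝ), (σ a : ℝ) * σ b * w σ = 0 := by
    refine sum_eq_zero_of_flipSpins B _ fun σ => ?_
    rw [hflip, flipSpins_of_mem ha, flipSpins_of_notMem hb]
    ring
  have hleft : ∑ σ : V → ({-1, 1} : Finset ℝ), (σ a : ℝ) * (σ b : ℝ) *
      Real.exp (β * ∑ e ∈ G.edgeFinset, edgeSpin σ e) =
      Real.sinh β * ∑ σ : V → ({-1, 1} : Finset ℝ), (σ c : ℝ) * σ b * w σ := by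
    rw [← add_zero (Real.sinh β * _), ← mul_zero (Real.cosh β), ← hzero, Finset.mul_sum,
      Finset.mul_sum, ← Finset.sum_add_distrib]
    refine Finset.sum_congr rfl fun σ _ => ?_
    rw [hsplit]
    linear_combination (σ b * σ c * Real.sinh β * w σ : ℝ) * spin_mul_self (σ a)
  have hright : ∑ σ : V → ({-1, 1} : Finset ℝ), (σ c : ℝ) * (σ b : ℝ) *
      Real.exp (β * ∑ e ∈ G.edgeFinset, edgeSpin σ e) =
      Real.cosh β * ∑ σ : V → ({-1, 1} : Finset ℝ), (σ c : ℝ) * σ b * w σ := by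
    rw [← add_zero (Real.cosh β * _), ← mul_zero (Real.sinh β), ← hzero, Finset.mul_sum,
      Finset.mul_sum, ← Finset.sum_add_distrib]
    refine Finset.sum_congr rfl fun σ _ => ?_
    rw [hsplit]
    linear_combination (σ a * σ b * Real.sinh β * w σ : ℝ) * spin_mul_self (σ c)
  rw [hleft, hright, ← mul_assoc, Real.tanh_eq_sinh_div_cosh,
    div_mul_cancel₀ _ (Real.cosh_pos β).ne']

lemma sum_two_point_of_isPath {V : Type*} [Fintype V] [DecidableEq V]
    (G : SimpleGraph V) [DecidableRel G.Adj] (hG : G.IsAcyclic) (β : ℝ) {a b : V}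
    (p : G.Walk a b) (hp : p.IsPath) :
    ∑ σ : V → ({-1, 1} : Finset ℝ), (σ a : ℝ) * (σ b : ℝ) *
        Real.exp (β * ∑ e ∈ G.edgeFinset, edgeSpin σ e) =
      Real.tanh β ^ p.length * ∑ σ : V → ({-1, 1} : Finset ℝ),
        Real.exp (β * ∑ e ∈ G.edgeFinset, edgeSpin σ e) := by
  induction p with
  | nil => simp [spin_mul_self]
  | @cons a c b hac p ih =>
    rw [SimpleGraph.Walk.cons_isPath_iff] at hp
    have hbridge : ¬ (G.deleteEdges {s(a, c)}).Reachable a c :=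
      SimpleGraph.isBridge_iff.mp (SimpleGraph.isAcyclic_iff_forall_adj_isBridge.mp hG hac)
    have hcb : (G.deleteEdges {s(a, c)}).Reachable c b :=
      ⟨p.toDeleteEdge s(a, c) fun h => hp.2 (p.fst_mem_support_of_mem_edges h)⟩
    rw [sum_two_point_of_cut G β {v | (G.deleteEdges {s(a, c)}).Reachable a v} hac
      (SimpleGraph.Reachable.refl a) (fun h => hbridge (h.trans hcb.symm)), ih hp.1,
      SimpleGraph.Walk.length_cons, pow_succ', mul_assoc]
    intro x y hxy hne
    have hadj : (G.deleteEdges {s(a, c)}).Adj x y :=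
      SimpleGraph.deleteEdges_adj.mpr ⟨hxy, hne⟩
    exact ⟨fun h => h.trans hadj.reachable, fun h => h.trans hadj.symm.reachable⟩

/-- The free-boundary Ising two-point function on a finite tree:
`⟨σ_a σ_b⟩ = (tanh β)^{d(a,b)}`, where `d(a,b)` is the graph distance. -/
theorem ising_two_point_function_on_tree {V : Type*} [Fintype V] [DecidableEq V]
    (G : SimpleGraph V) [DecidableRel G.Adj] (hG : G.IsTree)
    (β : ℝ) (a b : V) :
    (∑ σ : V → ({-1, 1} : Finset ℝ), (σ a : ℝ) * (σ b : ℝ) *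
        Real.exp (β * ∑ e ∈ G.edgeFinset,
          Sym2.lift ⟨fun x y => (σ x : ℝ) * (σ y : ℝ), fun x y => mul_comm _ _⟩ e))
      / (∑ σ : V → ({-1, 1} : Finset ℝ),
          Real.exp (β * ∑ e ∈ G.edgeFinset,
            Sym2.lift ⟨fun x y => (σ x : ℝ) * (σ y : ℝ), fun x y => mul_comm _ _⟩ e))
    = Real.tanh β ^ G.dist a b := by
  obtain ⟨p, hp, hlen⟩ := hG.connected.exists_path_of_dist a b
  have : Nonempty (V → ({-1, 1} : Finset ℝ)) := ⟨fun _ => ⟨1, by simp⟩⟩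
  rw [← hlen, div_eq_iff]
  · exact sum_two_point_of_isPath G hG.isAcyclic β p hp
  · exact (Finset.sum_pos (fun σ _ => Real.exp_pos _) Finset.univ_nonempty).ne'
end
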